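/- Let the feasible semidefinite system (P_SD) satisfy the assumption that Z = diag(I_r, 0) is a maximum rank slack. Then (P_SD) is badly behaved if and only if it has an elementary reformulation that is in bad normal form. -/

import Mathlib

open Matrix

/-- Trace inner product `S • T = trace(ST)` of square real matrices. -/
noncomputable def ip {k : ℕ} (S T : Matrix (Fin k) (Fin k) ℝ) : ℝ :=
  Matrix.trace (S * T)

/-- `x` is feasible for the semidefinite system `∑ xᵢ Aᵢ ⪯ B`. -/
def IsFeasible {n m : ℕ} (A : Fin m → Matrix (Fin n) (Fin n) ℝ)
    (B : Matrix (Fin n) (Fin n) ℝ) (x : Fin m → ℝ) : Prop :=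
  (B - ∑ i, x i • A i).PosSemidef

/-- The set of primal objective values `∑ cᵢ xᵢ` over feasible `x`. -/
def PrimalVals {n m : ℕ} (A : Fin m → Matrix (Fin n) (Fin n) ℝ)
    (B : Matrix (Fin n) (Fin n) ℝ) (c : Fin m → ℝ) : Set ℝ :=
  {s | ∃ x : Fin m → ℝ, IsFeasible A B x ∧ s = ∑ i, c i * x i}

/-- The system `∑ xᵢ Aᵢ ⪯ B` is badly behaved: for some `c` the primal optimal
value is finite (i.e. is a least upper bound `v`), but no dual feasible `Y`
achieves value `v`. -/
def BadlyBehaved {n m : ℕ} (A : Fin m → Matrix (Fin n) (Fin n) ℝ)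
    (B : Matrix (Fin n) (Fin n) ℝ) : Prop :=
  ∃ (c : Fin m → ℝ) (v : ℝ), IsLUB (PrimalVals A B c) v ∧
    ¬ ∃ Y : Matrix (Fin n) (Fin n) ℝ,
        Y.PosSemidef ∧ (∀ i, ip (A i) Y = c i) ∧ ip B Y = v

/-- `Zmat n r = diag(I_r, 0)`. -/
def Zmat (n r : ℕ) : Matrix (Fin n) (Fin n) ℝ :=
  Matrix.of fun i j => if i = j ∧ (i : ℕ) < r then (1 : ℝ) else 0

/-- `Zmat n r` is a maximum rank slack of `∑ xᵢ Aᵢ ⪯ B`: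
it is a slack and every slack has rank at most `r`. -/
def MaxRankSlack {n m : ℕ} (A : Fin m → Matrix (Fin n) (Fin n) ℝ)
    (B : Matrix (Fin n) (Fin n) ℝ) (r : ℕ) : Prop :=
  (∃ x : Fin m → ℝ, B - ∑ i, x i • A i = Zmat n r) ∧
  ∀ x : Fin m → ℝ, IsFeasible A B x → (B - ∑ i, x i • A i).rank ≤ r

/-- Lower-right `(n-r) × (n-r)` block. -/
def block22 {n : ℕ} (r : ℕ) (h : r ≤ n) (V : Matrix (Fin n) (Fin n) ℝ) :
    Matrix (Fin (n - r)) (Fin (n - r)) ℝ :=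
  Matrix.of fun i j => V ⟨r + i.1, by omega⟩ ⟨r + j.1, by omega⟩

/-- Upper-right `r × (n-r)` block. -/
def block12 {n : ℕ} (r : ℕ) (h : r ≤ n) (V : Matrix (Fin n) (Fin n) ℝ) :
    Matrix (Fin r) (Fin (n - r)) ℝ :=
  Matrix.of fun i j => V ⟨i.1, by omega⟩ ⟨r + j.1, by omega⟩

/-- The column space (range space) of a matrix. -/
def colSpace {p q : ℕ} (M : Matrix (Fin p) (Fin q) ℝ) : Submodule ℝ (Fin p → ℝ) :=
  LinearMap.range M.mulVecLin

/-- The "Bad condition": some linear combination `V` of the `Aᵢ` has `V₂₂ ⪰ 0`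
and `ℛ(V₁₂ᵀ) ⊄ ℛ(V₂₂)`. -/
def BadCond {n m : ℕ} (A : Fin m → Matrix (Fin n) (Fin n) ℝ) (r : ℕ) (h : r ≤ n) : Prop :=
  ∃ lam : Fin m → ℝ,
    (block22 r h (∑ i, lam i • A i)).PosSemidef ∧
    ¬ colSpace (block12 r h (∑ i, lam i • A i))ᵀ ≤
        colSpace (block22 r h (∑ i, lam i • A i))

/-- `padLow r h U = diag(0, U)` as an `n × n` matrix. -/
def padLow {n : ℕ} (r : ℕ) (h : r ≤ n) (U : Matrix (Fin (n - r)) (Fin (n - r)) ℝ) :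
    Matrix (Fin n) (Fin n) ℝ :=
  Matrix.of fun a b =>
    if hab : r ≤ (a : ℕ) ∧ r ≤ (b : ℕ) then U ⟨a.1 - r, by omega⟩ ⟨b.1 - r, by omega⟩
    else 0

/-- "Good condition 1": some positive definite `U` has `Aᵢ • diag(0, U) = 0` for all `i`. -/
def GoodCond1 {n m : ℕ} (A : Fin m → Matrix (Fin n) (Fin n) ℝ) (r : ℕ) (h : r ≤ n) : Prop :=
  ∃ U : Matrix (Fin (n - r)) (Fin (n - r)) ℝ, U.PosDef ∧ ∀ i, ip (A i) (padLow r h U) = 0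

/-- "Good condition 2": every linear combination of the `Aᵢ` with zero lower-right
block has zero upper-right block. -/
def GoodCond2 {n m : ℕ} (A : Fin m → Matrix (Fin n) (Fin n) ℝ) (r : ℕ) (h : r ≤ n) : Prop :=
  ∀ lam : Fin m → ℝ, block22 r h (∑ i, lam i • A i) = 0 →
    block12 r h (∑ i, lam i • A i) = 0

/-- `Tmat r h N = [[I_r, 0], [0, N]]`. -/
def Tmat {n : ℕ} (r : ℕ) (h : r ≤ n) (N : Matrix (Fin (n - r)) (Fin (n - r)) ℝ) :
    Matrix (Fin n) (Fin n) ℝ :=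
  Matrix.of fun a b =>
    if (a : ℕ) < r ∧ (b : ℕ) < r then (if a = b then (1 : ℝ) else 0)
    else if hab : r ≤ (a : ℕ) ∧ r ≤ (b : ℕ) then N ⟨a.1 - r, by omega⟩ ⟨b.1 - r, by omega⟩
    else 0

/-- The system `∑ xᵢ A'ᵢ ⪯ B'` is an elementary reformulation of `∑ xᵢ Aᵢ ⪯ B`:
there are an invertible `M : ℝ^{m×m}`, a vector `μ ∈ ℝ^m` and an invertible
`T = [[I_r, 0], [0, N]]` with `A'ᵢ = Tᵀ (∑ⱼ Mᵢⱼ Aⱼ) T` and `B' = Tᵀ (B + ∑ⱼ μⱼ Aⱼ) T`. -/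
def ElemReform {n m : ℕ} (r : ℕ) (h : r ≤ n)
    (A : Fin m → Matrix (Fin n) (Fin n) ℝ) (B : Matrix (Fin n) (Fin n) ℝ)
    (A' : Fin m → Matrix (Fin n) (Fin n) ℝ) (B' : Matrix (Fin n) (Fin n) ℝ) : Prop :=
  ∃ (M : Matrix (Fin m) (Fin m) ℝ) (μ : Fin m → ℝ)
    (N : Matrix (Fin (n - r)) (Fin (n - r)) ℝ),
    IsUnit M ∧ IsUnit (Tmat r h N) ∧
    (∀ i, A' i = (Tmat r h N)ᵀ * (∑ j, M i j • A j) * Tmat r h N) ∧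
    B' = (Tmat r h N)ᵀ * (B + ∑ j, μ j • A j) * Tmat r h N

/-- The last `n - r` columns of a square matrix, as an `n × (n-r)` matrix. -/
def lastCols {n : ℕ} (r : ℕ) (h : r ≤ n) (V : Matrix (Fin n) (Fin n) ℝ) :
    Matrix (Fin n) (Fin (n - r)) ℝ :=
  Matrix.of fun a j => V a ⟨r + j.1, by omega⟩

/-- Bad normal form of a semidefinite system. -/
def BadNormalForm {n m : ℕ} (A : Fin m → Matrix (Fin n) (Fin n) ℝ)
    (B : Matrix (Fin n) (Fin n) ℝ) (r : ℕ) (h : r ≤ n) : Prop :=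
  B = Zmat n r ∧ MaxRankSlack A B r ∧
  ∃ k : ℕ, ∃ hk : k < m,
    (∀ i : Fin m, (i : ℕ) < k → ∀ a b : Fin n, r ≤ (b : ℕ) → A i a b = 0) ∧
    (∀ i : Fin m, (i : ℕ) < k → ∀ a b : Fin n, r ≤ (a : ℕ) → A i a b = 0) ∧
    LinearIndependent ℝ (fun i : Fin (m - k) => lastCols r h (A ⟨k + i.1, by omega⟩)) ∧
    (block22 r h (A ⟨m - 1, by omega⟩)).PosSemidef

/-- Good normal form of a semidefinite system. -/
def GoodNormalForm {n m : ℕ} (A : Fin m → Matrix (Fin n) (Fin n) ℝ)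
    (B : Matrix (Fin n) (Fin n) ℝ) (r : ℕ) (h : r ≤ n) : Prop :=
  B = Zmat n r ∧ MaxRankSlack A B r ∧
  ∃ k : ℕ, ∃ _hk : k ≤ m,
    (∀ i : Fin m, (i : ℕ) < k → ∀ a b : Fin n,
        (r ≤ (a : ℕ) ∨ r ≤ (b : ℕ)) → A i a b = 0) ∧
    LinearIndependent ℝ (fun i : Fin (m - k) => block22 r h (A ⟨k + i.1, by omega⟩)) ∧
    ∃ U : Matrix (Fin (n - r)) (Fin (n - r)) ℝ, U.PosDef ∧
      ∀ i : Fin m, k ≤ (i : ℕ) → ip (block22 r h (A i)) U = 0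

/-- The image of the positive semidefinite cone under `Y ↦ (A₁ • Y, …, A_m • Y)`. -/
def imageSet {n m : ℕ} (A : Fin m → Matrix (Fin n) (Fin n) ℝ) : Set (Fin m → ℝ) :=
  {y | ∃ Y : Matrix (Fin n) (Fin n) ℝ, Y.PosSemidef ∧ ∀ i, ip (A i) Y = y i}


theorem Matrix.PosSemidef.fromBlocks_diag {ι κ : Type*} [Fintype ι] [Fintype κ]
    {P : Matrix ι ι ℝ} {Q : Matrix κ κ ℝ} (hP : P.PosSemidef) (hQ : Q.PosSemidef) :
    (fromBlocks P 0 0 Q).PosSemidef := by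
  refine PosSemidef.of_dotProduct_mulVec_nonneg
    (IsHermitian.fromBlocks hP.1 (by simp) hQ.1) fun x => ?_
  have h1 := hP.dotProduct_mulVec_nonneg (x ∘ Sum.inl)
  have h2 := hQ.dotProduct_mulVec_nonneg (x ∘ Sum.inr)
  have : star x ⬝ᵥ fromBlocks P 0 0 Q *ᵥ x =
      star (x ∘ Sum.inl) ⬝ᵥ P *ᵥ (x ∘ Sum.inl) + star (x ∘ Sum.inr) ⬝ᵥ Q *ᵥ (x ∘ Sum.inr) := by
    rw [fromBlocks_mulVec]
    simp [dotProduct, Fintype.sum_sum_type]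
  rw [this]
  exact add_nonneg h1 h2

theorem isHermitian_sum_smul {ι δ : Type*} [Fintype δ] {F : δ → Matrix ι ι ℝ}
    (hF : ∀ i, (F i).IsHermitian) (y : δ → ℝ) : (∑ i, y i • F i).IsHermitian := by
  rw [IsHermitian, conjTranspose_sum]
  exact Finset.sum_congr rfl fun i _ => by rw [conjTranspose_smul, (hF i).eq, star_trivial]

theorem trace_mul_vecMulVec_self {ι : Type*} [Fintype ι] (S : Matrix ι ι ℝ) (x : ι → ℝ) :
    trace (S * vecMulVec x x) = x ⬝ᵥ S *ᵥ x := by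
  rw [mul_vecMulVec, trace_vecMulVec, dotProduct_comm]

theorem Matrix.PosSemidef.trace_mul_nonneg_real {ι : Type*} [Fintype ι]
    {S Y : Matrix ι ι ℝ} (hS : S.PosSemidef) (hY : Y.PosSemidef) : 0 ≤ trace (S * Y) := by
  obtain ⟨d, w, rfl⟩ := posSemidef_iff_eq_sum_vecMulVec.1 hY
  rw [Matrix.mul_sum, trace_sum]
  refine Finset.sum_nonneg fun i _ => ?_
  rw [star_trivial, trace_mul_vecMulVec_self]
  simpa using hS.dotProduct_mulVec_nonneg (w i)

theorem Matrix.PosSemidef.abs_apply_le_trace {ι : Type*} [Fintype ι]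
    {Y : Matrix ι ι ℝ} (hY : Y.PosSemidef) (i j : ι) : |Y i j| ≤ trace Y := by
  classical
  have hle : ∀ k, Y k k ≤ trace Y := fun k =>
    Finset.single_le_sum (f := fun k => Y k k) (fun l _ => hY.diag_nonneg) (Finset.mem_univ k)
  have hs : Y j i = Y i j := by simpa using hY.1.apply i j
  have h1 := hY.dotProduct_mulVec_nonneg (Pi.single i 1 + Pi.single j 1)
  have h2 := hY.dotProduct_mulVec_nonneg (Pi.single i 1 - Pi.single j 1)
  simp [mulVec_add, mulVec_sub, add_dotProduct, sub_dotProduct] at h1 h2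
  have := hle i
  have := hle j
  rw [abs_le]
  constructor <;> linarith

theorem isClosed_setOf_posSemidef (ι : Type*) [Fintype ι] :
    IsClosed {Y : Matrix ι ι ℝ | Y.PosSemidef} := by
  simp only [posSemidef_iff_dotProduct_mulVec, IsHermitian, Set.ofPred_and, Set.ofPred_forall]
  refine (isClosed_eq (by fun_prop) continuous_id).inter (isClosed_iInter fun x => ?_)
  exact isClosed_le continuous_const (by fun_prop)

theorem isCompact_of_subset_box {ι : Type*} [Fintype ι] {s : Set (Matrix ι ι ℝ)} (C : ℝ)
    (hs : IsClosed s) (h : ∀ Y ∈ s, ∀ i j, |Y i j| ≤ C) : IsCompact s := by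
  have hbox : IsCompact (Set.univ.pi fun _ : ι => Set.univ.pi fun _ : ι => Set.Icc (-C) C) :=
    isCompact_univ_pi fun _ => isCompact_univ_pi fun _ => isCompact_Icc
  exact IsCompact.of_isClosed_subset (X := ι → ι → ℝ) hbox hs
    fun Y hY i _ j _ => abs_le.1 (h Y hY i j)

theorem convex_setOf_posSemidef (ι : Type*) [Fintype ι] :
    Convex ℝ {Y : Matrix ι ι ℝ | Y.PosSemidef} :=
  fun _ hX _ hY _ _ ha hb _ => (hX.smul ha).add (hY.smul hb)

theorem Matrix.exists_eq_trace_mul {ι : Type*} [Fintype ι] (g : Matrix ι ι ℝ →ₗ[ℝ] ℝ) :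
    ∃ W : Matrix ι ι ℝ, W.IsHermitian ∧ ∀ X : Matrix ι ι ℝ, X.IsHermitian →
      g X = trace (X * W) := by
  classical
  have key : ∀ X : Matrix ι ι ℝ, g X = trace (X * of fun j i => g (single i j 1)) := by
    intro X
    conv_lhs => rw [matrix_eq_sum_single X]
    simp only [map_sum, trace, diag, mul_apply, of_apply]
    refine Finset.sum_congr rfl fun i _ => Finset.sum_congr rfl fun j _ => ?_
    rw [show single i j (X i j) = X i j • single i j (1 : ℝ) by simp, map_smul, smul_eq_mul]
  set W : Matrix ι ι ℝ := of fun j i => g (single i j 1) with hW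
  refine ⟨(2⁻¹ : ℝ) • (W + Wᵀ), ?_, fun X hX => ?_⟩
  · ext i j
    simp only [smul_apply, star_trivial, conjTranspose_apply, add_apply, transpose_apply, add_comm]
  · have h2 : trace (X * Wᵀ) = trace (X * W) := by
      have hXt : Xᵀ = X := by simpa [IsHermitian, conjTranspose_eq_transpose_of_trivial] using hX
      rw [← trace_transpose, transpose_mul, transpose_transpose, hXt, trace_mul_comm]
    rw [key X, mul_smul_comm, Matrix.mul_add, trace_smul, trace_add, h2, smul_eq_mul]
    ring

theorem Matrix.PosDef.exists_smul_sub_posSemidef {ι : Type*} [Fintype ι] {U H : Matrix ι ι ℝ}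
    (hU : U.PosDef) (hH : H.IsHermitian) : ∃ C : ℝ, 0 < C ∧ (C • U - H).PosSemidef := by
  let s : Set (ι → ℝ) := {x | x ⬝ᵥ x = 1}
  have hs : IsCompact s := by
    have hbox : IsCompact (Set.univ.pi fun _ : ι => Set.Icc (-1 : ℝ) 1) :=
      isCompact_univ_pi fun _ => isCompact_Icc
    refine hbox.of_isClosed_subset (isClosed_eq (by fun_prop) continuous_const) ?_
    intro x hx i _
    have : x i * x i ≤ x ⬝ᵥ x :=
      Finset.single_le_sum (f := fun i => x i * x i) (fun j _ => mul_self_nonneg _)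
        (Finset.mem_univ i)
    rw [show x ⬝ᵥ x = 1 from hx] at this
    exact abs_le.1 (abs_le_one_iff_mul_self_le_one.2 this)
  have hpos : ∀ x : ι → ℝ, x ≠ 0 → 0 < x ⬝ᵥ U *ᵥ x := fun x hx => by
    simpa using hU.dotProduct_mulVec_pos hx
  have hs0 : ∀ x ∈ s, x ≠ 0 := by
    rintro x hx rfl
    simp [s] at hx
  have hc : ContinuousOn (fun x : ι → ℝ => (x ⬝ᵥ H *ᵥ x) / (x ⬝ᵥ U *ᵥ x)) s :=
    ContinuousOn.div (by fun_prop) (by fun_prop) fun x hx => (hpos x (hs0 x hx)).ne'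
  obtain ⟨C, hC⟩ := hs.bddAbove_image hc
  have hC' : ∀ x ∈ s, x ⬝ᵥ H *ᵥ x ≤ max C 1 * (x ⬝ᵥ U *ᵥ x) := fun x hx => by
    have := (hC ⟨x, hx, rfl⟩).trans (le_max_left C 1)
    rwa [div_le_iff₀ (hpos x (hs0 x hx))] at this
  refine ⟨max C 1, by positivity, PosSemidef.of_dotProduct_mulVec_nonneg ?_ fun x => ?_⟩
  · exact IsHermitian.sub (by simpa [IsHermitian, conjTranspose_smul] using congrArg (max C 1 • ·) hU.1.eq) hH
  · simp only [star_trivial, sub_mulVec, dotProduct_sub, smul_mulVec, dotProduct_smul, smul_eq_mul]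
    by_cases hx : x = 0
    · simp [hx]
    have hxx : 0 < x ⬝ᵥ x := by simpa using Matrix.dotProduct_star_self_pos_iff.2 hx
    set t := Real.sqrt (x ⬝ᵥ x) with ht
    have ht0 : 0 < t := Real.sqrt_pos.2 hxx
    have htt : t * t = x ⬝ᵥ x := Real.mul_self_sqrt hxx.le
    have hmem : t⁻¹ • x ∈ s := by
      simp only [s, Set.mem_ofPred_eq, smul_dotProduct, dotProduct_smul, smul_eq_mul, ← htt]
      field_simp
    have h := hC' _ hmem
    simp only [mulVec_smul, smul_dotProduct, dotProduct_smul, smul_eq_mul] at h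
    have h2 := mul_le_mul_of_nonneg_left h (mul_self_nonneg t)
    have e1 : t * t * (t⁻¹ * (t⁻¹ * (x ⬝ᵥ H *ᵥ x))) = x ⬝ᵥ H *ᵥ x := by field_simp
    have e2 : t * t * (max C 1 * (t⁻¹ * (t⁻¹ * (x ⬝ᵥ U *ᵥ x)))) = max C 1 * (x ⬝ᵥ U *ᵥ x) := by
      field_simp
    rw [e1, e2] at h2
    linarith

/-- A subspace of symmetric matrices meeting the positive semidefinite cone only at `0` is
orthogonal to some positive definite matrix. -/
theorem exists_posDef_orthogonal {κ : Type*} [Fintype κ]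
    (L : Submodule ℝ (Matrix κ κ ℝ)) (hL : ∀ H ∈ L, H.IsHermitian)
    (h : ∀ H ∈ L, H.PosSemidef → H = 0) :
    ∃ U : Matrix κ κ ℝ, U.PosDef ∧ ∀ H ∈ L, trace (H * U) = 0 := by
  classical
  have : LocallyConvexSpace ℝ (Matrix κ κ ℝ) :=
    inferInstanceAs (LocallyConvexSpace ℝ (κ → κ → ℝ))
  let Q : Set (Matrix κ κ ℝ) := {Y | Y.PosSemidef} ∩ {Y | trace Y = 1}
  have hQconv : Convex ℝ Q := (convex_setOf_posSemidef κ).inter fun X hX Y hY a b _ _ hab => by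
    simp only [Set.mem_ofPred_eq] at hX hY ⊢
    simp [trace_add, trace_smul, hX, hY, hab]
  have hQc : IsCompact Q := by
    refine isCompact_of_subset_box 1 ((isClosed_setOf_posSemidef κ).inter
      (isClosed_eq (by fun_prop) continuous_const)) ?_
    rintro Y ⟨hY, hY1⟩ i j
    exact (hY.abs_apply_le_trace i j).trans_eq hY1
  have hdisj : Disjoint Q (L : Set (Matrix κ κ ℝ)) := by
    rw [Set.disjoint_left]
    rintro Y ⟨hY, hY1⟩ hYL
    have := h Y hYL hY
    subst this
    simp at hY1
  obtain ⟨f, u, v, hf1, huv, hf2⟩ := geometric_hahn_banach_compact_closed hQconv hQc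
    L.convex L.closed_of_finiteDimensional hdisj
  have hv : v < 0 := by simpa using hf2 0 L.zero_mem
  have hfL : ∀ H ∈ L, f H = 0 := by
    intro H hH
    by_contra hne
    have := hf2 ((v / f H) • H) (L.smul_mem _ hH)
    rw [map_smul, smul_eq_mul, div_mul_cancel₀ _ hne] at this
    exact lt_irrefl _ this
  obtain ⟨W, hW, hfW⟩ := Matrix.exists_eq_trace_mul (f : Matrix κ κ ℝ →ₗ[ℝ] ℝ)
  refine ⟨-W, PosDef.of_dotProduct_mulVec_pos hW.neg fun x hx => ?_, fun H hH => ?_⟩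
  · have hxx : 0 < x ⬝ᵥ x := by simpa using Matrix.dotProduct_star_self_pos_iff.2 hx
    have hpsd : (vecMulVec x x).PosSemidef := by simpa using posSemidef_vecMulVec_self_star x
    have h1 := hf1 ((x ⬝ᵥ x)⁻¹ • vecMulVec x x)
      ⟨hpsd.smul (inv_nonneg.2 hxx.le), by
        simp [trace_smul, trace_vecMulVec, inv_mul_cancel₀ hxx.ne']⟩
    rw [map_smul, smul_eq_mul] at h1
    have h2 := hfW _ hpsd.1
    rw [trace_mul_comm, trace_mul_vecMulVec_self] at h2
    have h3 : f (vecMulVec x x) = x ⬝ᵥ W *ᵥ x := h2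
    rw [h3] at h1
    have h4 : (x ⬝ᵥ x)⁻¹ * (x ⬝ᵥ W *ᵥ x) < 0 := by linarith
    have h5 : x ⬝ᵥ W *ᵥ x < 0 := by
      by_contra hcon
      exact absurd h4 (not_lt.2 (mul_nonneg (inv_nonneg.2 hxx.le) (not_lt.1 hcon)))
    simp only [star_trivial, neg_mulVec, dotProduct_neg]
    linarith
  · rw [Matrix.mul_neg, trace_neg, ← hfW H (hL H hH)]
    simp [hfL H hH]

/-- Dual attainment for a semidefinite system whose constant term is the identity. -/
theorem exists_dual_of_identity {ι δ : Type*} [Fintype ι] [DecidableEq ι] [Fintype δ]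
    (F : δ → Matrix ι ι ℝ) (hF : ∀ i, (F i).IsHermitian) (c : δ → ℝ) (v : ℝ)
    (h : ∀ y : δ → ℝ, (1 - ∑ i, y i • F i).PosSemidef → ∑ i, c i * y i ≤ v) :
    ∃ Y : Matrix ι ι ℝ, Y.PosSemidef ∧ trace Y ≤ v ∧ ∀ i, trace (F i * Y) = c i := by
  classical
  have hv : 0 ≤ v := by simpa using h 0 (by simpa using PosSemidef.one)
  have hsum : ∀ y : δ → ℝ, (∑ i, y i • F i).IsHermitian := isHermitian_sum_smul hF
  let Q : Set (Matrix ι ι ℝ) := {Y | Y.PosSemidef} ∩ {Y | trace Y ≤ v}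
  have hQconv : Convex ℝ Q := (convex_setOf_posSemidef ι).inter
    (convex_halfSpace_le (traceLinearMap ι ℝ ℝ).isLinear v)
  have hQc : IsCompact Q := by
    refine isCompact_of_subset_box v ((isClosed_setOf_posSemidef ι).inter
      (isClosed_le (by fun_prop) continuous_const)) ?_
    rintro Y ⟨hY, hY1⟩ i j
    exact (hY.abs_apply_le_trace i j).trans hY1
  let Φ : Matrix ι ι ℝ →ₗ[ℝ] (δ → ℝ) :=
    LinearMap.pi fun i => (traceLinearMap ι ℝ ℝ) ∘ₗ LinearMap.mulLeft ℝ (F i)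
  have hΦ : ∀ Y i, Φ Y i = trace (F i * Y) := fun Y i => rfl
  have hΦc : Continuous Φ := by
    refine continuous_pi fun i => ?_
    simp only [hΦ]
    fun_prop
  by_cases hmem : c ∈ Φ '' Q
  · obtain ⟨Y, ⟨hY, hYv⟩, rfl⟩ := hmem
    exact ⟨Y, hY, hYv, fun i => rfl⟩
  exfalso
  obtain ⟨f, u, hf1, hf2⟩ := geometric_hahn_banach_closed_point
    (hQconv.linear_image Φ) (hQc.image hΦc).isClosed hmem
  let y : δ → ℝ := fun i => f (Pi.single i 1)
  have hf : ∀ z : δ → ℝ, f z = ∑ i, z i * y i := by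
    intro z
    conv_lhs => rw [pi_eq_sum_univ' z]
    simp [y, map_sum]
  have hΦf : ∀ Y, f (Φ Y) = trace ((∑ i, y i • F i) * Y) := by
    intro Y
    rw [hf, Finset.sum_mul, trace_sum]
    simp [hΦ, trace_smul, mul_comm]
  have hu : 0 < u := by
    have := hf1 (Φ 0) ⟨0, ⟨PosSemidef.zero, by simpa using hv⟩, rfl⟩
    simpa using this
  have hcy : u < ∑ i, c i * y i := by rw [← hf]; exact hf2
  rcases hv.eq_or_lt with rfl | hv0
  · obtain ⟨C, hC, hpsd⟩ := (PosDef.one (n := ι) (R := ℝ)).exists_smul_sub_posSemidef (hsum y)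
    have h1 := h (C⁻¹ • y) (by
      have := hpsd.smul (inv_nonneg.2 hC.le)
      rw [smul_sub, smul_smul, inv_mul_cancel₀ hC.ne', one_smul, Finset.smul_sum] at this
      simpa [smul_smul] using this)
    have h2 : ∑ i, c i * (C⁻¹ • y) i = C⁻¹ * ∑ i, c i * y i := by
      rw [Finset.mul_sum]
      exact Finset.sum_congr rfl fun i _ => by simp; ring
    rw [h2] at h1
    have : 0 < C⁻¹ * ∑ i, c i * y i := mul_pos (inv_pos.2 hC) (hu.trans hcy)
    linarith
  · have h1 := h ((v / u) • y) (by
      refine PosSemidef.of_dotProduct_mulVec_nonneg ?_ fun x => ?_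
      · exact isHermitian_one.sub (hsum _)
      by_cases hx : x = 0
      · simp [hx]
      have hxx : 0 < x ⬝ᵥ x := by simpa using Matrix.dotProduct_star_self_pos_iff.2 hx
      have hpsd : (vecMulVec x x).PosSemidef := by simpa using posSemidef_vecMulVec_self_star x
      have h3 := hf1 _ ⟨(v / (x ⬝ᵥ x)) • vecMulVec x x,
        ⟨hpsd.smul (div_nonneg hv hxx.le), by
          simp [trace_smul, trace_vecMulVec, div_mul_cancel₀ _ hxx.ne']⟩, rfl⟩
      rw [hΦf, mul_smul_comm, trace_smul, trace_mul_vecMulVec_self, smul_eq_mul] at h3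
      have h4 : ∑ i, ((v / u) • y) i • F i = (v / u) • ∑ i, y i • F i := by
        simp [Finset.smul_sum, smul_smul]
      rw [h4]
      simp only [star_trivial, sub_mulVec, one_mulVec, dotProduct_sub, smul_mulVec,
        dotProduct_smul, smul_eq_mul]
      set q := x ⬝ᵥ (∑ i, y i • F i) *ᵥ x
      rw [div_mul_eq_mul_div, div_lt_iff₀ hxx] at h3
      have : v / u * q ≤ x ⬝ᵥ x := by
        rw [div_mul_eq_mul_div, div_le_iff₀ hu]
        linarith
      linarith)
    have h2 : ∑ i, c i * ((v / u) • y) i = v / u * ∑ i, c i * y i := by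
      rw [Finset.mul_sum]
      exact Finset.sum_congr rfl fun i _ => by simp; ring
    rw [h2, div_mul_eq_mul_div, div_le_iff₀ hu] at h1
    have := mul_lt_mul_of_pos_left hcy hv0
    linarith

theorem trace_fromBlocks_eq_add {ι κ : Type*} [Fintype ι] [Fintype κ] (P : Matrix ι ι ℝ)
    (Q : Matrix ι κ ℝ) (R : Matrix κ ι ℝ) (S : Matrix κ κ ℝ) :
    trace (fromBlocks P Q R S) = trace P + trace S := by
  simp [trace, diag, Fintype.sum_sum_type]

theorem LinearMap.exists_comp_eq_of_ker_le {K V W : Type*} [Field K] [AddCommGroup V] [Module K V]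
    [AddCommGroup W] [Module K W] (f : V →ₗ[K] W) (g : V →ₗ[K] K)
    (h : ∀ x, f x = 0 → g x = 0) : ∃ l : W →ₗ[K] K, ∀ x, l (f x) = g x := by
  have : g ∈ LinearMap.range f.dualMap := by
    rw [LinearMap.range_dualMap_eq_dualAnnihilator_ker, Submodule.mem_dualAnnihilator]
    exact fun x hx => h x hx
  obtain ⟨l, rfl⟩ := this
  exact ⟨l, fun x => rfl⟩

/-- Dual attainment in block form, when every combination of the constraint matrices whose
lower-right block is positive semidefinite vanishes outside of the upper-left block. -/
theorem exists_dual_of_blocks {ι κ δ : Type*} [Fintype ι] [Fintype κ] [DecidableEq ι] [Fintype δ]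
    (A : δ → Matrix (ι ⊕ κ) (ι ⊕ κ) ℝ) (hA : ∀ i, (A i).IsHermitian) (c : δ → ℝ) (v : ℝ)
    (hgood : ∀ y : δ → ℝ, (∑ i, y i • A i).toBlocks₂₂.PosSemidef →
      (∑ i, y i • A i).toBlocks₂₂ = 0 ∧ (∑ i, y i • A i).toBlocks₁₂ = 0)
    (hv : IsLUB {s | ∃ y : δ → ℝ, (fromBlocks 1 0 0 0 - ∑ i, y i • A i).PosSemidef ∧
      s = ∑ i, c i * y i} v) :
    ∃ Y : Matrix (ι ⊕ κ) (ι ⊕ κ) ℝ, Y.PosSemidef ∧ (∀ i, trace (A i * Y) = c i) ∧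
      trace (fromBlocks 1 0 0 0 * Y) = v := by
  classical
  let G : (δ → ℝ) →ₗ[ℝ] Matrix (ι ⊕ κ) (ι ⊕ κ) ℝ := Fintype.linearCombination ℝ A
  have hG : ∀ y, G y = ∑ i, y i • A i := fun y => Fintype.linearCombination_apply ℝ A y
  have hGh : ∀ y, (G y).IsHermitian := fun y => hG y ▸ isHermitian_sum_smul hA y
  simp only [← hG] at hgood hv
  let p₁ : Matrix (ι ⊕ κ) (ι ⊕ κ) ℝ →ₗ[ℝ] Matrix ι ι ℝ :=
    { toFun := toBlocks₁₁, map_add' := fun _ _ => rfl, map_smul' := fun _ _ => rfl }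
  let p₂ : Matrix (ι ⊕ κ) (ι ⊕ κ) ℝ →ₗ[ℝ] Matrix κ κ ℝ :=
    { toFun := toBlocks₂₂, map_add' := fun _ _ => rfl, map_smul' := fun _ _ => rfl }
  let c' : (δ → ℝ) →ₗ[ℝ] ℝ := Fintype.linearCombination ℝ c
  have hc' : ∀ y, c' y = ∑ i, c i * y i := fun y => by
    simp [c', Fintype.linearCombination_apply, mul_comm]
  let H : (δ → ℝ) →ₗ[ℝ] Matrix κ κ ℝ := p₂ ∘ₗ G
  let b := Module.finBasis ℝ (LinearMap.ker H)
  have hker : ∀ y ∈ LinearMap.ker H, G y = fromBlocks (p₁ (G y)) 0 0 0 := by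
    intro y hy
    have h22 : (G y).toBlocks₂₂ = 0 := hy
    have h12 := (hgood y (h22 ▸ PosSemidef.zero)).2
    have h21 : (G y).toBlocks₂₁ = 0 := by
      ext i j
      have h := (hGh y).apply (Sum.inr i) (Sum.inl j)
      have h' := congrFun (congrFun h12 j) i
      simp only [toBlocks₁₂, of_apply, Matrix.zero_apply] at h'
      simp only [toBlocks₂₁, of_apply, Matrix.zero_apply]
      rw [← h, h', star_zero]
    conv_lhs => rw [← fromBlocks_toBlocks (G y), h12, h21, h22]
    rfl
  obtain ⟨Y₁, hY₁, htr, hFY⟩ := exists_dual_of_identity (fun i => p₁ (G (b i)))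
    (fun i => (hGh _).submatrix Sum.inl) (fun i => c' (b i)) v (by
      intro y hy
      set z : LinearMap.ker H := ∑ i, y i • b i with hz
      have hz' : (z : δ → ℝ) = ∑ i, y i • (b i : δ → ℝ) := by simp [hz]
      refine hv.1 ⟨z, ?_, ?_⟩
      · have hp : p₁ (G z) = ∑ i, y i • p₁ (G (b i)) := by simp [hz']
        rw [hker z z.2, hp, sub_eq_add_neg, fromBlocks_neg, fromBlocks_add]
        simpa [sub_eq_add_neg] using hy.fromBlocks_diag (PosSemidef.zero (n := κ))
      · rw [← hc', hz']
        simp [mul_comm])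
  let ℓ : (δ → ℝ) →ₗ[ℝ] ℝ :=
    c' - traceLinearMap ι ℝ ℝ ∘ₗ LinearMap.mulRight ℝ Y₁ ∘ₗ p₁ ∘ₗ G
  have hℓ : ∀ y, ℓ y = c' y - trace (p₁ (G y) * Y₁) := fun y => rfl
  have hℓ0 : ∀ y, H y = 0 → ℓ y = 0 := by
    intro y hy
    have : ℓ ∘ₗ (LinearMap.ker H).subtype = 0 := b.ext fun i => by
      simp [hℓ, hFY]
    exact LinearMap.congr_fun this ⟨y, hy⟩
  obtain ⟨l, hl⟩ := LinearMap.exists_comp_eq_of_ker_le H ℓ hℓ0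
  obtain ⟨W, hW, hlW⟩ := Matrix.exists_eq_trace_mul l
  have hHh : ∀ y, (H y).IsHermitian := fun y => (hGh y).submatrix Sum.inr
  obtain ⟨U, hU, hUH⟩ := exists_posDef_orthogonal (LinearMap.range H)
    (by rintro _ ⟨y, rfl⟩; exact hHh y) (by rintro _ ⟨y, rfl⟩ hy; exact (hgood y hy).1)
  obtain ⟨C, -, hC⟩ := hU.exists_smul_sub_posSemidef hW.neg
  have hY₂ : ∀ y, trace (H y * (C • U - -W)) = ℓ y := by
    intro y
    rw [sub_neg_eq_add, Matrix.mul_add, trace_add, mul_smul_comm, trace_smul,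
      hUH _ ⟨y, rfl⟩, ← hlW _ (hHh y), hl]
    simp
  have hAY : ∀ y, trace (G y * fromBlocks Y₁ 0 0 (C • U - -W)) = c' y := by
    intro y
    have h1 : trace (G y * fromBlocks Y₁ 0 0 (C • U - -W)) =
        trace (p₁ (G y) * Y₁) + trace (H y * (C • U - -W)) := by
      conv_lhs => rw [← fromBlocks_toBlocks (G y)]
      rw [fromBlocks_multiply, trace_fromBlocks_eq_add]
      simp only [Matrix.mul_zero, add_zero, zero_add]
      rfl
    rw [h1, hY₂, hℓ]
    ring
  have hYpsd := hY₁.fromBlocks_diag hC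
  have hZY : trace (fromBlocks 1 0 0 0 * fromBlocks Y₁ 0 0 (C • U - -W)) = trace Y₁ := by
    rw [fromBlocks_multiply, trace_fromBlocks_eq_add]
    simp
  refine ⟨_, hYpsd, fun i => ?_, le_antisymm (hZY.trans_le htr) (hv.2 ?_)⟩
  · have := hAY (Pi.single i 1)
    simpa [hG, hc', Pi.single_apply] using this
  · rintro _ ⟨y, hy, rfl⟩
    have := hy.trace_mul_nonneg_real hYpsd
    rw [Matrix.sub_mul, trace_sub, hAY, hc'] at this
    linarith

/-- The equivalence splitting `Fin n` into its first `r` and its last `n - r` elements. -/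
def finSplit {n : ℕ} (r : ℕ) (h : r ≤ n) : Fin r ⊕ Fin (n - r) ≃ Fin n :=
  finSumFinEquiv.trans (finCongr (by omega))

theorem finSplit_inl {n r : ℕ} (h : r ≤ n) (i : Fin r) :
    finSplit r h (Sum.inl i) = ⟨i.1, by omega⟩ := by
  ext; simp [finSplit]

theorem finSplit_inr {n r : ℕ} (h : r ≤ n) (i : Fin (n - r)) :
    finSplit r h (Sum.inr i) = ⟨r + i.1, by omega⟩ := by
  ext; simp [finSplit]

theorem Zmat_submatrix_finSplit {n r : ℕ} (h : r ≤ n) :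
    (Zmat n r).submatrix (finSplit r h) (finSplit r h) = fromBlocks 1 0 0 0 := by
  ext (i | i) (j | j) <;>
    simp only [submatrix_apply, finSplit_inl, finSplit_inr, Zmat, of_apply, fromBlocks_apply₁₁,
      fromBlocks_apply₁₂, fromBlocks_apply₂₁, fromBlocks_apply₂₂, Matrix.zero_apply, one_apply,
      Fin.ext_iff]
  · simp
  · have := i.2
    rw [if_neg (by omega)]
  · rw [if_neg (by omega)]
  · rw [if_neg (by omega)]

theorem trace_submatrix_mul_submatrix {ι κ : Type*} [Fintype ι] [Fintype κ] (e : ι ≃ κ)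
    (S T : Matrix κ κ ℝ) : trace (S.submatrix e e * T.submatrix e e) = trace (S * T) := by
  rw [submatrix_mul_equiv]
  exact e.sum_comp fun i => (S * T) i i

theorem not_badlyBehaved_Zmat {n m r : ℕ} (hr : r ≤ n) (A : Fin m → Matrix (Fin n) (Fin n) ℝ)
    (hA : ∀ i, (A i).IsSymm)
    (hgood : ∀ y : Fin m → ℝ, (block22 r hr (∑ i, y i • A i)).PosSemidef →
      lastCols r hr (∑ i, y i • A i) = 0) : ¬ BadlyBehaved A (Zmat n r) := by
  rintro ⟨c, v, hv, hno⟩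
  apply hno
  set e := finSplit r hr with he
  have hsum : ∀ y : Fin m → ℝ, ∑ i, y i • (A i).submatrix e e = (∑ i, y i • A i).submatrix e e := by
    intro y
    ext a b
    simp [Matrix.sum_apply]
  obtain ⟨Y, hY, hAY, hZY⟩ := exists_dual_of_blocks (fun i => (A i).submatrix e e)
    (fun i => by
      have : (A i).IsHermitian := by
        rw [IsHermitian, conjTranspose_eq_transpose_of_trivial]; exact hA i
      exact this.submatrix e) c v (by
      intro y hy
      rw [hsum] at hy ⊢
      have h22 : ((∑ i, y i • A i).submatrix e e).toBlocks₂₂ = block22 r hr (∑ i, y i • A i) := by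
        ext a b
        simp only [toBlocks₂₂, of_apply, submatrix_apply, block22, he, finSplit_inr]
      rw [h22] at hy
      have h0 := hgood y hy
      constructor
      · ext a b
        have := congrFun (congrFun h0 (e (Sum.inr a))) b
        simpa only [toBlocks₂₂, of_apply, submatrix_apply, lastCols, he, finSplit_inr, finSplit_inl, Matrix.zero_apply] using this
      · ext a b
        have := congrFun (congrFun h0 (e (Sum.inl a))) b
        simpa only [toBlocks₁₂, of_apply, submatrix_apply, lastCols, he, finSplit_inr, finSplit_inl, Matrix.zero_apply] using this)
    (by
      convert hv using 1
      ext s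
      refine exists_congr fun y => and_congr_left fun _ => ?_
      rw [hsum, ← Zmat_submatrix_finSplit hr]
      exact posSemidef_submatrix_equiv (M := Zmat n r - ∑ i, y i • A i) e)
  have hYe : (Y.submatrix e.symm e.symm).submatrix e e = Y := by ext; simp
  refine ⟨Y.submatrix e.symm e.symm, hY.submatrix _, fun i => ?_, ?_⟩
  · rw [ip, ← trace_submatrix_mul_submatrix e, hYe, hAY]
  · rw [ip, ← trace_submatrix_mul_submatrix e, hYe, Zmat_submatrix_finSplit, hZY]

theorem slack_reformulation {n m : ℕ} (A A' : Fin m → Matrix (Fin n) (Fin n) ℝ)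
    (B B' T : Matrix (Fin n) (Fin n) ℝ) (M : Matrix (Fin m) (Fin m) ℝ) (μ : Fin m → ℝ)
    (hA' : ∀ i, A' i = Tᵀ * (∑ j, M i j • A j) * T) (hB' : B' = Tᵀ * (B + ∑ j, μ j • A j) * T)
    (x : Fin m → ℝ) :
    B' - ∑ i, x i • A' i = Tᵀ * (B - ∑ j, (x ᵥ* M - μ) j • A j) * T := by
  have h1 : ∑ i, x i • A' i = Tᵀ * (∑ j, (x ᵥ* M) j • A j) * T := by
    have : ∑ j, (x ᵥ* M) j • A j = ∑ i, x i • ∑ j, M i j • A j := by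
      simp only [vecMul, dotProduct, Finset.sum_smul, Finset.smul_sum, smul_smul]
      exact Finset.sum_comm
    rw [this, Matrix.mul_sum, Matrix.sum_mul]
    exact Finset.sum_congr rfl fun i _ => by rw [hA', mul_smul_comm, smul_mul_assoc]
  rw [h1, hB', ← Matrix.sub_mul, ← Matrix.mul_sub]
  congr 2
  simp only [Pi.sub_apply, sub_smul, Finset.sum_sub_distrib]
  abel

theorem BadlyBehaved.of_reformulation {n m : ℕ} {A A' : Fin m → Matrix (Fin n) (Fin n) ℝ}
    {B B' T : Matrix (Fin n) (Fin n) ℝ} {M : Matrix (Fin m) (Fin m) ℝ} {μ : Fin m → ℝ}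
    (hM : IsUnit M) (hT : IsUnit T)
    (hA' : ∀ i, A' i = Tᵀ * (∑ j, M i j • A j) * T) (hB' : B' = Tᵀ * (B + ∑ j, μ j • A j) * T)
    (h : BadlyBehaved A' B') : BadlyBehaved A B := by
  obtain ⟨c', v, hv, hno⟩ := h
  have hMM := Matrix.mul_nonsing_inv M ((Matrix.isUnit_iff_isUnit_det M).1 hM)
  have hMM' := Matrix.nonsing_inv_mul M ((Matrix.isUnit_iff_isUnit_det M).1 hM)
  have hTT := Matrix.mul_nonsing_inv T ((Matrix.isUnit_iff_isUnit_det T).1 hT)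
  set c := M⁻¹ *ᵥ c' with hc
  have hc' : c' = M *ᵥ c := by rw [hc, mulVec_mulVec, hMM, one_mulVec]
  have hslack := slack_reformulation A A' B B' T M μ hA' hB'
  have hfeas : ∀ x, IsFeasible A' B' x ↔ IsFeasible A B (x ᵥ* M - μ) := by
    intro x
    rw [IsFeasible, hslack, IsFeasible, ← conjTranspose_eq_transpose_of_trivial]
    exact hT.posSemidef_star_left_conjugate_iff
  have hval : ∀ x, c ⬝ᵥ (x ᵥ* M - μ) = c' ⬝ᵥ x - c ⬝ᵥ μ := by
    intro x
    rw [dotProduct_sub, hc', dotProduct_comm (M *ᵥ c), dotProduct_mulVec, dotProduct_comm c]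
  refine ⟨c, v - c ⬝ᵥ μ, ⟨?_, ?_⟩, ?_⟩
  · rintro _ ⟨y, hy, rfl⟩
    have hyx : ((y + μ) ᵥ* M⁻¹) ᵥ* M - μ = y := by
      rw [vecMul_vecMul, hMM', vecMul_one, add_sub_cancel_right]
    have h1 : c' ⬝ᵥ ((y + μ) ᵥ* M⁻¹) ≤ v :=
      hv.1 ⟨(y + μ) ᵥ* M⁻¹, (hfeas _).2 (by rwa [hyx]), rfl⟩
    have h2 := hval ((y + μ) ᵥ* M⁻¹)
    rw [hyx] at h2
    change c ⬝ᵥ y ≤ _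
    linarith
  · intro u hu
    have : v ≤ u + c ⬝ᵥ μ := hv.2 (by
      rintro _ ⟨x, hx, rfl⟩
      have h1 : c ⬝ᵥ (x ᵥ* M - μ) ≤ u := hu ⟨_, (hfeas x).1 hx, rfl⟩
      rw [hval] at h1
      change c' ⬝ᵥ x ≤ _
      linarith)
    linarith
  · rintro ⟨Y, hY, hAY, hBY⟩
    have htr : ∀ W, ip (Tᵀ * W * T) (T⁻¹ * Y * T⁻¹ᵀ) = ip W Y := by
      intro W
      have hTt : T⁻¹ᵀ * Tᵀ = 1 := by rw [← transpose_mul, hTT, transpose_one]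
      rw [ip, trace_mul_comm, ip]
      calc trace (T⁻¹ * Y * T⁻¹ᵀ * (Tᵀ * W * T))
          = trace (T⁻¹ * (Y * (T⁻¹ᵀ * Tᵀ) * W * T)) := by simp only [Matrix.mul_assoc]
        _ = trace (Y * (T⁻¹ᵀ * Tᵀ) * W * (T * T⁻¹)) := by
            rw [trace_mul_comm]; simp only [Matrix.mul_assoc]
        _ = trace (W * Y) := by rw [hTt, hTT, Matrix.mul_one, Matrix.mul_one, trace_mul_comm]
    have hlin : ∀ y : Fin m → ℝ, ip (∑ j, y j • A j) Y = y ⬝ᵥ c := by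
      intro y
      simp only [ip, dotProduct, Matrix.sum_mul, trace_sum, smul_mul_assoc, trace_smul, smul_eq_mul]
      exact Finset.sum_congr rfl fun j _ => by rw [← hAY j]; rfl
    refine hno ⟨T⁻¹ * Y * T⁻¹ᵀ, ?_, fun i => ?_, ?_⟩
    · rw [← conjTranspose_eq_transpose_of_trivial]
      exact hY.mul_mul_conjTranspose_same _
    · rw [hA', htr, hlin, hc']
      rfl
    · have : ip (B + ∑ j, μ j • A j) Y = ip B Y + ip (∑ j, μ j • A j) Y := by
        simp only [ip, Matrix.add_mul, trace_add]
      rw [hB', htr, this, hBY, hlin, dotProduct_comm]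
      ring

theorem exists_basis_apply_eq {K V : Type*} [Field K] [AddCommGroup V] [Module K V]
    [FiniteDimensional K V] {d : ℕ} (hd : Module.finrank K V = d) (i : Fin d) {x : V} (hx : x ≠ 0) :
    ∃ b : Module.Basis (Fin d) K V, b i = x := by
  classical
  have hli : LinearIndepOn K id ({x} : Set V) := LinearIndepOn.singleton hx
  let b₀ := Module.Basis.extend hli
  let b₁ := b₀.reindex (Fintype.equivFinOfCardEq
    ((Module.finrank_eq_card_basis b₀).symm.trans hd))
  have hx' : x ∈ Set.range b₁ := by
    rw [Module.Basis.range_reindex, Module.Basis.range_extend]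
    exact Module.Basis.subset_extend hli rfl
  obtain ⟨j, hj⟩ := hx'
  exact ⟨b₁.reindex (Equiv.swap j i), by simp [hj]⟩

/-- Rows adapted to the kernel of a linear map, the last of them a prescribed vector outside of
the kernel. -/
theorem exists_adapted_rows {m : ℕ} {W : Type*} [AddCommGroup W] [Module ℝ W]
    (φ : (Fin m → ℝ) →ₗ[ℝ] W) {x : Fin m → ℝ} (hx : φ x ≠ 0) :
    ∃ (M : Matrix (Fin m) (Fin m) ℝ) (k : ℕ) (hk : k < m), IsUnit M ∧
      (∀ i : Fin m, (i : ℕ) < k → φ (M i) = 0) ∧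
      LinearIndependent ℝ (fun i : Fin (m - k) => φ (M ⟨k + i.1, by omega⟩)) ∧
      M ⟨m - 1, by omega⟩ = x := by
  set k := Module.finrank ℝ (LinearMap.ker φ) with hk
  have hsum := φ.finrank_range_add_finrank_ker
  rw [← hk, Module.finrank_fin_fun] at hsum
  have hx' : (⟨φ x, x, rfl⟩ : LinearMap.range φ) ≠ 0 := fun h => hx (congrArg Subtype.val h)
  have hpos : 0 < Module.finrank ℝ (LinearMap.range φ) :=
    Module.finrank_pos_iff_exists_ne_zero.2 ⟨_, hx'⟩
  have hkm : k < m := by omega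
  have hd : Module.finrank ℝ (LinearMap.range φ) = m - k := by omega
  obtain ⟨w, hw⟩ := exists_basis_apply_eq hd ⟨m - k - 1, by omega⟩ hx'
  have hlift : ∀ i, ∃ u, φ u = w i ∧ (i = ⟨m - k - 1, by omega⟩ → u = x) := by
    intro i
    by_cases hi : i = ⟨m - k - 1, by omega⟩
    · exact ⟨x, by rw [hi, hw], fun _ => rfl⟩
    · obtain ⟨u, hu⟩ := (w i).2
      exact ⟨u, hu, fun h => absurd h hi⟩
  choose u hu hux using hlift
  let b := Module.finBasis ℝ (LinearMap.ker φ)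
  have hφu : LinearIndependent ℝ (fun i => φ (u i)) := by
    simp only [hu]
    exact w.linearIndependent.map' (LinearMap.range φ).subtype (Submodule.ker_subtype _)
  have hbli : LinearIndependent ℝ (fun i => (b i : Fin m → ℝ)) :=
    b.linearIndependent.map' (LinearMap.ker φ).subtype (Submodule.ker_subtype _)
  have hdisj : Disjoint (Submodule.span ℝ (Set.range fun i => (b i : Fin m → ℝ)))
      (Submodule.span ℝ (Set.range u)) := by
    refine (Submodule.range_ker_disjoint (f := φ) hφu).symm.mono_left (Submodule.span_le.2 ?_)
    rintro _ ⟨i, rfl⟩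
    exact (b i).2
  have hall := hbli.sum_type (LinearIndependent.of_comp φ hφu) hdisj
  let e := finSplit k hkm.le
  let M : Matrix (Fin m) (Fin m) ℝ :=
    of fun i => Sum.elim (fun i => (b i : Fin m → ℝ)) u (e.symm i)
  have hMr : ∀ i : Fin (m - k), M ⟨k + i.1, by omega⟩ = u i := by
    intro i
    have : e.symm ⟨k + i.1, by omega⟩ = Sum.inr i := by
      rw [Equiv.symm_apply_eq]; exact (finSplit_inr hkm.le i).symm
    change Sum.elim _ u (e.symm _) = _
    rw [this, Sum.elim_inr]
  refine ⟨M, k, hkm, ?_, ?_, ?_, ?_⟩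
  · rw [← Matrix.linearIndependent_rows_iff_isUnit]
    exact hall.comp e.symm e.symm.injective
  · intro i hi
    have : e.symm i = Sum.inl ⟨i, hi⟩ := by
      rw [Equiv.symm_apply_eq]; exact (finSplit_inl hkm.le ⟨i, hi⟩).symm
    change φ (Sum.elim _ u (e.symm i)) = 0
    rw [this, Sum.elim_inl]
    exact (b _).2
  · simp only [hMr]
    exact hφu
  · have := hMr ⟨m - k - 1, by omega⟩
    rw [hux _ rfl] at this
    rw [← this]
    congr 1
    ext
    simp only
    omega

theorem isSymm_sum_smul {ι δ : Type*} [Fintype δ] {F : δ → Matrix ι ι ℝ}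
    (hF : ∀ i, (F i).IsSymm) (y : δ → ℝ) : (∑ i, y i • F i).IsSymm := by
  rw [IsSymm, transpose_sum]
  exact Finset.sum_congr rfl fun i _ => by rw [transpose_smul, (hF i).eq]

theorem Tmat_one {n r : ℕ} (h : r ≤ n) : Tmat r h 1 = 1 := by
  ext a b
  simp only [Tmat, of_apply, one_apply, Fin.ext_iff]
  split_ifs <;> first | rfl | omega

theorem Zmat_eq_diagonal (n r : ℕ) :
    Zmat n r = diagonal fun i : Fin n => if (i : ℕ) < r then (1 : ℝ) else 0 := by
  ext i j
  by_cases h : i = j <;> simp [Zmat, h]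

theorem Zmat_posSemidef (n r : ℕ) : (Zmat n r).PosSemidef := by
  rw [Zmat_eq_diagonal]
  refine PosSemidef.diagonal fun i => ?_
  simp only [Pi.zero_apply]
  split_ifs <;> simp

theorem rank_Zmat {n r : ℕ} (h : r ≤ n) : (Zmat n r).rank = r := by
  rw [Zmat_eq_diagonal, Matrix.rank_diagonal]
  rw [Fintype.card_subtype]
  simp [Fin.card_filter_val_lt, h]

/-- Every slack of a system with maximum rank slack `diag(I_r, 0)` has its last columns zero. -/
theorem slack_apply_eq_zero {n m r : ℕ} (hr : r ≤ n) {A : Fin m → Matrix (Fin n) (Fin n) ℝ}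
    (hmax : MaxRankSlack A (Zmat n r) r) {x : Fin m → ℝ} (hx : IsFeasible A (Zmat n r) x)
    (a b : Fin n) (hb : r ≤ (b : ℕ)) : (Zmat n r - ∑ i, x i • A i) a b = 0 := by
  set S := Zmat n r - ∑ i, x i • A i with hS
  have hSpsd : S.PosSemidef := hx
  have hR : Zmat n r - ∑ i, ((2⁻¹ : ℝ) • x) i • A i = (2⁻¹ : ℝ) • (Zmat n r + S) := by
    have : ∑ i, ((2⁻¹ : ℝ) • x) i • A i = (2⁻¹ : ℝ) • ∑ i, x i • A i := by
      simp [Finset.smul_sum, smul_smul]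
    rw [this, hS]
    module
  have hRpsd : ((2⁻¹ : ℝ) • (Zmat n r + S)).PosSemidef :=
    ((Zmat_posSemidef n r).add hSpsd).smul (by norm_num)
  have hrank := hmax.2 ((2⁻¹ : ℝ) • x) (by rw [IsFeasible, hR]; exact hRpsd)
  rw [hR] at hrank
  set R := (2⁻¹ : ℝ) • (Zmat n r + S) with hRdef
  have hker : ∀ z : Fin n → ℝ, R *ᵥ z = 0 → Zmat n r *ᵥ z = 0 ∧ S *ᵥ z = 0 := by
    intro z hz
    have h1 := (Zmat_posSemidef n r).dotProduct_mulVec_nonneg z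
    have h2 := hSpsd.dotProduct_mulVec_nonneg z
    have h3 : star z ⬝ᵥ R *ᵥ z = 0 := by rw [hz, dotProduct_zero]
    rw [hRdef, smul_mulVec, add_mulVec, dotProduct_smul, dotProduct_add, smul_eq_mul] at h3
    exact ⟨((Zmat_posSemidef n r).dotProduct_mulVec_zero_iff z).1 (by linarith),
      (hSpsd.dotProduct_mulVec_zero_iff z).1 (by linarith)⟩
  have hle : LinearMap.ker R.mulVecLin ≤ LinearMap.ker (Zmat n r).mulVecLin :=
    fun z hz => (hker z hz).1
  have hdimR := R.mulVecLin.finrank_range_add_finrank_ker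
  have hdimZ := (Zmat n r).mulVecLin.finrank_range_add_finrank_ker
  have hZr := rank_Zmat hr
  rw [Matrix.rank] at hrank hZr
  have heq := Submodule.eq_of_le_of_finrank_le hle (by omega)
  have hmem : Pi.single b 1 ∈ LinearMap.ker (Zmat n r).mulVecLin := by
    rw [LinearMap.mem_ker, mulVecLin_apply, mulVec_single_one]
    ext i
    simp only [Zmat, col_apply, of_apply, Pi.zero_apply]
    rw [if_neg]
    rintro ⟨rfl, h⟩
    omega
  rw [← heq] at hmem
  have := congrFun (hker _ hmem).2 a
  rwa [mulVec_single_one] at this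

theorem ip_nonneg_of_ip_Zmat_eq_zero {n r : ℕ} (hr : r ≤ n) {V Y : Matrix (Fin n) (Fin n) ℝ}
    (hV : (block22 r hr V).PosSemidef) (hY : Y.PosSemidef) (hZY : ip (Zmat n r) Y = 0) :
    0 ≤ ip V Y := by
  obtain ⟨d, w, rfl⟩ := posSemidef_iff_eq_sum_vecMulVec.1 hY
  simp only [ip, Matrix.mul_sum, trace_sum, star_trivial, trace_mul_vecMulVec_self] at hZY ⊢
  rw [Finset.sum_eq_zero_iff_of_nonneg fun i _ => by
    simpa using (Zmat_posSemidef n r).dotProduct_mulVec_nonneg (w i)] at hZY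
  refine Finset.sum_nonneg fun i hi => ?_
  have hZw : Zmat n r *ᵥ w i = 0 :=
    ((Zmat_posSemidef n r).dotProduct_mulVec_zero_iff (w i)).1 (by simpa using hZY i hi)
  have hw : ∀ a : Fin n, (a : ℕ) < r → w i a = 0 := by
    intro a ha
    have := congrFun hZw a
    rw [Zmat_eq_diagonal, mulVec_diagonal] at this
    simpa [ha] using this
  have h := hV.dotProduct_mulVec_nonneg fun j => w i (finSplit r hr (Sum.inr j))
  convert h using 1
  simp only [dotProduct, mulVec, ← (finSplit r hr).sum_comp, Fintype.sum_sum_type]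
  have hw' : ∀ a : Fin r, w i ⟨a, a.2.trans_le hr⟩ = 0 := fun a => hw _ a.2
  simp only [finSplit_inl, finSplit_inr, hw', block22, of_apply, star_trivial,
    mul_zero, zero_mul, Finset.sum_const_zero, zero_add]

theorem badlyBehaved_of_linearIndependent_lastCols {n m r k : ℕ} (hr : r ≤ n)
    (A : Fin m → Matrix (Fin n) (Fin n) ℝ) (hmax : MaxRankSlack A (Zmat n r) r) (hk : k < m)
    (hcol : ∀ i : Fin m, (i : ℕ) < k → ∀ a b : Fin n, r ≤ (b : ℕ) → A i a b = 0)
    (hli : LinearIndependent ℝ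
      (fun i : Fin (m - k) => lastCols r hr (A ⟨k + i.1, by omega⟩)))
    (hpsd : (block22 r hr (A ⟨m - 1, by omega⟩)).PosSemidef) : BadlyBehaved A (Zmat n r) := by
  have hzero : ∀ x, IsFeasible A (Zmat n r) x → x ⟨m - 1, by omega⟩ = 0 := by
    intro x hx
    have hsum : ∑ i : Fin (m - k),
        x ⟨k + i.1, by omega⟩ • lastCols r hr (A ⟨k + i.1, by omega⟩) = 0 := by
      ext a j
      have h := slack_apply_eq_zero hr hmax hx a ⟨r + j.1, by omega⟩ (by simp)
      have hZ0 : Zmat n r a ⟨r + j.1, by omega⟩ = 0 := by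
        simp only [Zmat, of_apply]
        rw [if_neg]
        rintro ⟨h1, h2⟩
        have := congrArg Fin.val h1
        simp only at this
        omega
      rw [Matrix.sub_apply, hZ0, zero_sub, neg_eq_zero, Matrix.sum_apply,
        ← (finSplit k hk.le).sum_comp, Fintype.sum_sum_type] at h
      simp only [finSplit_inl, finSplit_inr, Matrix.smul_apply, smul_eq_mul] at h
      rw [Finset.sum_eq_zero fun i _ => by
        rw [hcol ⟨i, by omega⟩ i.2 a ⟨r + j.1, by omega⟩ (by simp), mul_zero], zero_add] at h
      simpa [Matrix.sum_apply, lastCols] using h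
    have h := Fintype.linearIndependent_iff.1 hli (fun i => x ⟨k + i.1, by omega⟩) hsum
      ⟨m - 1 - k, by omega⟩
    rw [← h]
    congr 1
    ext
    simp only
    omega
  refine ⟨Pi.single ⟨m - 1, by omega⟩ (-1), 0, ⟨?_, fun u hu => hu ⟨0, ?_, ?_⟩⟩, ?_⟩
  · rintro _ ⟨x, hx, rfl⟩
    simp [Pi.single_apply, hzero x hx]
  · simpa [IsFeasible] using Zmat_posSemidef n r
  · simp
  · rintro ⟨Y, hY, hAY, hZY⟩
    have h := ip_nonneg_of_ip_Zmat_eq_zero hr hpsd hY hZY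
    rw [hAY, Pi.single_eq_same] at h
    norm_num at h

/-- Under the maximum rank slack assumption, the feasible system
is badly behaved iff it has an elementary reformulation in bad normal form. -/
theorem stmt2 {n m : ℕ} (hn : 0 < n) (hm : 0 < m)
    (A : Fin m → Matrix (Fin n) (Fin n) ℝ) (B : Matrix (Fin n) (Fin n) ℝ)
    (hA : ∀ i, (A i).IsSymm) (hB : B.IsSymm)
    (hfeas : ∃ x : Fin m → ℝ, IsFeasible A B x)
    (r : ℕ) (hr : r ≤ n) (hZ : MaxRankSlack A B r) :
    BadlyBehaved A B ↔
      ∃ (A' : Fin m → Matrix (Fin n) (Fin n) ℝ) (B' : Matrix (Fin n) (Fin n) ℝ),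
        ElemReform r hr A B A' B' ∧ BadNormalForm A' B' r hr := by
  constructor
  · intro hbad
    obtain ⟨x₀, hx₀⟩ := hZ.1
    have hBx : B = 1ᵀ * (Zmat n r + ∑ j, x₀ j • A j) * 1 := by simp [← hx₀]
    have hbadZ : BadlyBehaved A (Zmat n r) := hbad.of_reformulation isUnit_one isUnit_one
      (fun i => by simp [one_apply]) hBx
    have hex : ∃ y : Fin m → ℝ, (block22 r hr (∑ i, y i • A i)).PosSemidef ∧
        lastCols r hr (∑ i, y i • A i) ≠ 0 := by
      by_contra! hcon
      exact not_badlyBehaved_Zmat hr A hA hcon hbadZ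
    obtain ⟨y, hy, hy0⟩ := hex
    let φ : (Fin m → ℝ) →ₗ[ℝ] Matrix (Fin n) (Fin (n - r)) ℝ :=
      { toFun := lastCols r hr, map_add' := fun _ _ => rfl, map_smul' := fun _ _ => rfl } ∘ₗ
        Fintype.linearCombination ℝ A
    have hφ : ∀ z, φ z = lastCols r hr (∑ i, z i • A i) := fun z => rfl
    obtain ⟨M, k, hk, hM, hM0, hMli, hMx⟩ := exists_adapted_rows φ (x := y) hy0
    let A' : Fin m → Matrix (Fin n) (Fin n) ℝ := fun i => ∑ j, M i j • A j
    have hA' : ∀ i, A' i = (Tmat r hr 1)ᵀ * (∑ j, M i j • A j) * Tmat r hr 1 := fun i => by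
      simp [Tmat_one, A']
    have hB' : Zmat n r = (Tmat r hr 1)ᵀ * (B + ∑ j, (-x₀) j • A j) * Tmat r hr 1 := by
      simp [Tmat_one, ← hx₀, sub_eq_add_neg]
    have hslack := slack_reformulation A A' B (Zmat n r) (Tmat r hr 1) M (-x₀) hA' hB'
    simp only [Tmat_one, transpose_one, Matrix.one_mul, Matrix.mul_one] at hslack
    have hcol : ∀ i : Fin m, (i : ℕ) < k → ∀ a b : Fin n, r ≤ (b : ℕ) → A' i a b = 0 := by
      intro i hi a b hb
      have h := congrFun (congrFun (hM0 i hi) a) ⟨b - r, by omega⟩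
      have hbe : (⟨r + (b - r), by omega⟩ : Fin n) = b := by ext; simp only; omega
      simpa only [hφ, lastCols, of_apply, hbe, Matrix.zero_apply] using h
    refine ⟨A', Zmat n r, ⟨M, -x₀, 1, hM, by rw [Tmat_one]; exact isUnit_one, hA', hB'⟩, rfl,
      ⟨⟨0, by simp⟩, fun x hx => ?_⟩, k, hk, hcol, fun i hi a b ha => ?_, hMli, ?_⟩
    · rw [IsFeasible, hslack] at hx
      rw [hslack]
      exact hZ.2 _ hx
    · exact ((isSymm_sum_smul hA (M i)).apply b a).trans (hcol i hi b a ha)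
    · have : A' ⟨m - 1, by omega⟩ = ∑ i, y i • A i := by simp only [A', hMx]
      rwa [this]
  · rintro ⟨A', B', ⟨M, μ, N, hM, hT, hA', hB'⟩, rfl, hmax, k, hk, hcol, -, hli, hpsd⟩
    refine BadlyBehaved.of_reformulation hM hT hA' hB' ?_
    refine badlyBehaved_of_linearIndependent_lastCols hr A' hmax hk hcol hli hpsd
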